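/- arXiv:2601.00824 — 5 statements merged into one kernel-verified Lean document; each statement's English description precedes it below -/
import Mathlib

section
/- Let E₁ and E₂ be real vector spaces with distinguished elements u₁, u₂, and let T₁ : E₁ → E₁ and T₂ : E₂ → E₂ be linear maps. If T₁^n(u₁ - T₁(u₁)) = 0 and T₂^m(u₂ - T₂(u₂)) = 0, then for N = max(n, m), the tensor product map satisfies (T₁ ⊗ T₂)^N(u₁ ⊗ u₂ - (T₁ ⊗ T₂)(u₁ ⊗ u₂)) = 0. -/
open TensorProduct

/-- Once an iterate of `T` annihilates `u - T u`, all later iterates of `T` take the same value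
at `T u` and at `u`. -/
theorem Module.End.pow_apply_apply_eq_of_le {R M : Type*} [Ring R] [AddCommGroup M] [Module R M]
    {T : Module.End R M} {u : M} {n N : ℕ} (h : (T ^ n) (u - T u) = 0) (hN : n ≤ N) :
    (T ^ N) (T u) = (T ^ N) u := by
  have key : (T ^ N) (u - T u) = 0 := by
    rw [← Nat.sub_add_cancel hN, pow_add, Module.End.mul_apply, h, map_zero]
  rw [map_sub, sub_eq_zero] at key
  exact key.symm

/-- Parallel composition bound: if the defects of `T₁` and `T₂` are annihilated
after `n` and `m` iterations respectively, then the defect of `T₁ ⊗ T₂` is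
annihilated after `max n m` iterations. -/
theorem stmt_6 {E₁ E₂ : Type*} [AddCommGroup E₁] [Module ℝ E₁]
    [AddCommGroup E₂] [Module ℝ E₂]
    (u₁ : E₁) (u₂ : E₂) (T₁ : Module.End ℝ E₁) (T₂ : Module.End ℝ E₂)
    (n m : ℕ)
    (h₁ : (T₁ ^ n) (u₁ - T₁ u₁) = 0) (h₂ : (T₂ ^ m) (u₂ - T₂ u₂) = 0) :
    ((TensorProduct.map T₁ T₂ : Module.End ℝ (E₁ ⊗[ℝ] E₂)) ^ (max n m))
      (u₁ ⊗ₜ[ℝ] u₂ - TensorProduct.map T₁ T₂ (u₁ ⊗ₜ[ℝ] u₂)) = 0 := by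
  rw [TensorProduct.map_pow, map_sub, TensorProduct.map_tmul, TensorProduct.map_tmul,
    TensorProduct.map_tmul, Module.End.pow_apply_apply_eq_of_le h₁ (le_max_left n m),
    Module.End.pow_apply_apply_eq_of_le h₂ (le_max_right n m), sub_self]
end

section
/- Let s ≥ 1 and let α : M_s → M_s be the completely positive map on s × s complex matrices given in Kraus form α(X) = ∑_{i ∈ ι} L_iᴴ · X · L_i for a finite family of matrices L_i. If α^m = 0 for some m ≥ 1, then α^s = 0; in particular the nilpotency index of α is at most s. -/
open Matrix ComplexOrder

/-- The subspace of vectors annihilated by every product of `k` matrices of the family `L`. -/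
def wordKernel {n ι R : Type*} [Fintype n] [CommSemiring R] (L : ι → Matrix n n R) :
    ℕ → Submodule R (n → R)
  | 0 => ⊥
  | k + 1 => ⨅ i, (wordKernel L k).comap (L i).mulVecLin

theorem mem_wordKernel_succ {n ι R : Type*} [Fintype n] [CommSemiring R] (L : ι → Matrix n n R)
    (k : ℕ) (v : n → R) :
    v ∈ wordKernel L (k + 1) ↔ ∀ i, L i *ᵥ v ∈ wordKernel L k := by
  simp [wordKernel]

theorem wordKernel_mono {n ι R : Type*} [Fintype n] [CommSemiring R] (L : ι → Matrix n n R) :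
    Monotone (wordKernel L) := by
  refine monotone_nat_of_le_succ fun k => ?_
  induction k with
  | zero => exact bot_le
  | succ k ih =>
    intro v hv
    rw [mem_wordKernel_succ] at hv ⊢
    exact fun i => ih (hv i)

theorem wordKernel_add_eq_of_eq_succ {n ι R : Type*} [Fintype n] [CommSemiring R]
    (L : ι → Matrix n n R) {k : ℕ} (h : wordKernel L k = wordKernel L (k + 1)) (j : ℕ) :
    wordKernel L (k + j) = wordKernel L k := by
  induction j with
  | zero => rfl
  | succ j ih =>
    rw [← add_assoc, h]
    ext v
    simp only [mem_wordKernel_succ, ih]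

theorem wordKernel_card_eq_top {n ι K : Type*} [Fintype n] [Field K] (L : ι → Matrix n n K)
    {m : ℕ} (hm : wordKernel L m = ⊤) : wordKernel L (Fintype.card n) = ⊤ := by
  have key (k : ℕ) : wordKernel L k = ⊤ ∨ k ≤ Module.finrank K (wordKernel L k) := by
    induction k with
    | zero => exact Or.inr (Nat.zero_le _)
    | succ k ih =>
      have hle : wordKernel L k ≤ wordKernel L (k + 1) := wordKernel_mono L k.le_succ
      rcases ih with h | h
      · exact Or.inl (top_le_iff.mp (h ▸ hle))
      · rcases hle.eq_or_lt with heq | hlt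
        · left
          rw [← heq, ← wordKernel_add_eq_of_eq_succ L heq m, ← top_le_iff, ← hm]
          exact wordKernel_mono L (Nat.le_add_left m k)
        · exact Or.inr (h.trans_lt (Submodule.finrank_lt_finrank_of_lt hlt))
  rcases key (Fintype.card n) with h | h
  · exact h
  · refine Submodule.eq_top_of_finrank_eq (le_antisymm (Submodule.finrank_le _) ?_)
    simpa using h

section Kraus

variable {n ι : Type*} [Fintype n] [Fintype ι] {L : ι → Matrix n n ℂ}
  {α : Module.End ℂ (Matrix n n ℂ)}

theorem kraus_pow_mulVec_eq_zero (hα : ∀ X, α X = ∑ i, (L i)ᴴ * X * L i) (X : Matrix n n ℂ)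
    {k : ℕ} {v : n → ℂ} (hv : v ∈ wordKernel L k) : (α ^ k) X *ᵥ v = 0 := by
  induction k generalizing v with
  | zero =>
    have hv' : v = 0 := hv
    simp [hv']
  | succ k ih =>
    rw [mem_wordKernel_succ] at hv
    rw [pow_succ', Module.End.mul_apply, hα, Matrix.sum_mulVec]
    refine Finset.sum_eq_zero fun i _ => ?_
    rw [← Matrix.mulVec_mulVec, ← Matrix.mulVec_mulVec, ih (hv i), Matrix.mulVec_zero]

variable [DecidableEq n]

theorem kraus_pow_one_posSemidef (hα : ∀ X, α X = ∑ i, (L i)ᴴ * X * L i) (k : ℕ) :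
    ((α ^ k) 1).PosSemidef := by
  induction k with
  | zero => exact Matrix.PosSemidef.one
  | succ k ih =>
    rw [pow_succ', Module.End.mul_apply, hα]
    exact Matrix.posSemidef_sum _ fun i _ => ih.conjTranspose_mul_mul_same (L i)

theorem mem_wordKernel_of_dotProduct_kraus_pow_one
    (hα : ∀ X, α X = ∑ i, (L i)ᴴ * X * L i) {k : ℕ} {v : n → ℂ}
    (hv : star v ⬝ᵥ ((α ^ k) 1 *ᵥ v) = 0) : v ∈ wordKernel L k := by
  induction k generalizing v with
  | zero =>
    have hv' : v = 0 := by simpa using hv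
    simp [hv']
  | succ k ih =>
    have hexpand : star v ⬝ᵥ ((α ^ (k + 1)) 1 *ᵥ v) =
        ∑ i, star (L i *ᵥ v) ⬝ᵥ ((α ^ k) 1 *ᵥ (L i *ᵥ v)) := by
      rw [pow_succ', Module.End.mul_apply, hα, Matrix.sum_mulVec, dotProduct_sum]
      refine Finset.sum_congr rfl fun i _ => ?_
      rw [← Matrix.mulVec_mulVec, ← Matrix.mulVec_mulVec, Matrix.dotProduct_mulVec,
        Matrix.star_mulVec]
    rw [hexpand, Finset.sum_eq_zero_iff_of_nonneg fun i _ =>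
      (kraus_pow_one_posSemidef hα k).dotProduct_mulVec_nonneg _] at hv
    exact (mem_wordKernel_succ L k v).mpr fun i => ih (hv i (Finset.mem_univ i))

end Kraus

/-- Nilpotent CP maps have bounded index: if `α(X) = ∑ i, L_iᴴ X L_i` on
`s × s` complex matrices satisfies `α^m = 0` for some `m ≥ 1`, then `α^s = 0`. -/
theorem stmt_12 {s : ℕ} (hs : 1 ≤ s) {ι : Type*} [Fintype ι]
    (L : ι → Matrix (Fin s) (Fin s) ℂ)
    (α : Module.End ℂ (Matrix (Fin s) (Fin s) ℂ))
    (hα : ∀ X, α X = ∑ i, (L i)ᴴ * X * L i)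
    (m : ℕ) (hm : 1 ≤ m) (hnil : α ^ m = 0) :
    α ^ s = 0 := by
  have htop : wordKernel L m = ⊤ := by
    refine (Submodule.eq_top_iff').mpr fun v => ?_
    exact mem_wordKernel_of_dotProduct_kraus_pow_one hα (by simp [hnil])
  have hs_top : wordKernel L s = ⊤ := by simpa using wordKernel_card_eq_top L htop
  refine LinearMap.ext fun X => Matrix.ext_iff_mulVec.mpr fun v => ?_
  rw [kraus_pow_mulVec_eq_zero hα X (hs_top ▸ Submodule.mem_top : v ∈ wordKernel L s)]
  simp
end

section
/- Let d ≥ 1 and let T : M_d → M_d be the completely positive map T(X) = ∑_{i ∈ ι} V_iᴴ · X · V_i for a finite family of matrices V_i, and assume T is subunital: T(1) ≤ 1 in the Loewner order. If there exists n ≥ 1 with T^n(1 - T(1)) = 0, then T^d(1 - T(1)) = 0. -/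
open Matrix ComplexOrder

section KrausMap

variable {d : ℕ} {ι : Type*} [Fintype ι] {V : ι → Matrix (Fin d) (Fin d) ℂ}
  {T : Module.End ℂ (Matrix (Fin d) (Fin d) ℂ)}

lemma posSemidef_pow_apply (hT : ∀ X, T X = ∑ i, (V i)ᴴ * X * V i)
    {A : Matrix (Fin d) (Fin d) ℂ} (hA : A.PosSemidef) (k : ℕ) :
    ((T ^ k) A).PosSemidef := by
  induction k with
  | zero => simpa using hA
  | succ k ih =>
    rw [pow_succ', Module.End.mul_apply, hT]
    exact posSemidef_sum _ fun i _ => ih.conjTranspose_mul_mul_same (V i)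

lemma kraus_mulVec_eq_zero_iff (hT : ∀ X, T X = ∑ i, (V i)ᴴ * X * V i)
    {A : Matrix (Fin d) (Fin d) ℂ} (hA : A.PosSemidef) (v : Fin d → ℂ) :
    T A *ᵥ v = 0 ↔ ∀ i, A *ᵥ (V i *ᵥ v) = 0 := by
  have hTA : (T A).PosSemidef := by simpa using posSemidef_pow_apply hT hA 1
  have hsum : star v ⬝ᵥ T A *ᵥ v = ∑ i, star (V i *ᵥ v) ⬝ᵥ A *ᵥ (V i *ᵥ v) := by
    rw [hT, sum_mulVec, dotProduct_sum]
    refine Finset.sum_congr rfl fun i _ => ?_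
    rw [← mulVec_mulVec, ← mulVec_mulVec, dotProduct_mulVec, star_mulVec]
  rw [← hTA.dotProduct_mulVec_zero_iff, hsum,
    Finset.sum_eq_zero_iff_of_nonneg fun i _ => hA.dotProduct_mulVec_nonneg _]
  simp only [Finset.mem_univ, true_imp_iff, hA.dotProduct_mulVec_zero_iff]

/-- The common kernel of the matrices `T ^ j A` with `j ≥ k`. -/
def tailKer (T : Module.End ℂ (Matrix (Fin d) (Fin d) ℂ)) (A : Matrix (Fin d) (Fin d) ℂ)
    (k : ℕ) : Submodule ℂ (Fin d → ℂ) :=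
  ⨅ j, LinearMap.ker ((T ^ (j + k)) A).mulVecLin

lemma mem_tailKer {A : Matrix (Fin d) (Fin d) ℂ} {k : ℕ} {v : Fin d → ℂ} :
    v ∈ tailKer T A k ↔ ∀ j, (T ^ (j + k)) A *ᵥ v = 0 := by
  simp [tailKer]

lemma monotone_tailKer (A : Matrix (Fin d) (Fin d) ℂ) : Monotone (tailKer T A) :=
  monotone_nat_of_le_succ fun k v hv => mem_tailKer.2 fun j => by
    simpa [add_right_comm, add_assoc] using mem_tailKer.1 hv (j + 1)

lemma mem_tailKer_succ (hT : ∀ X, T X = ∑ i, (V i)ᴴ * X * V i)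
    {A : Matrix (Fin d) (Fin d) ℂ} (hA : A.PosSemidef) {k : ℕ} {v : Fin d → ℂ} :
    v ∈ tailKer T A (k + 1) ↔ ∀ i, V i *ᵥ v ∈ tailKer T A k := by
  simp only [mem_tailKer, ← add_assoc, pow_succ', Module.End.mul_apply,
    kraus_mulVec_eq_zero_iff hT (posSemidef_pow_apply hT hA _)]
  exact forall_comm

lemma finrank_tailKer_eq (hT : ∀ X, T X = ∑ i, (V i)ᴴ * X * V i)
    {A : Matrix (Fin d) (Fin d) ℂ} (hA : A.PosSemidef) {m : ℕ} (hm : d ≤ m) :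
    Module.finrank ℂ (tailKer T A m) = Module.finrank ℂ (tailKer T A d) := by
  refine Nat.stabilises_of_monotone (f := fun k => Module.finrank ℂ (tailKer T A k))
    (fun a b h => Submodule.finrank_mono (monotone_tailKer A h))
    (fun k => by simpa using Submodule.finrank_le (tailKer T A k)) (fun k hk => ?_) hm
  have heq := Submodule.eq_of_le_of_finrank_eq (monotone_tailKer A k.le_succ) hk
  have : tailKer T A (k + 1) = tailKer T A (k + 2) := by
    ext v
    rw [mem_tailKer_succ hT hA, mem_tailKer_succ hT hA, heq]
  exact congrArg (fun W : Submodule ℂ (Fin d → ℂ) => Module.finrank ℂ W) this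

end KrausMap

/-- CP dimension bound: for a completely positive subunital map
`T(X) = ∑ i, V_iᴴ X V_i` on `d × d` matrices (subunital meaning `1 - T(1)` is
positive semidefinite in the Loewner order), if `T^n(1 - T(1)) = 0` for some
`n ≥ 1`, then `T^d(1 - T(1)) = 0`. -/
theorem stmt_13 {d : ℕ} (hd : 1 ≤ d) {ι : Type*} [Fintype ι]
    (V : ι → Matrix (Fin d) (Fin d) ℂ)
    (T : Module.End ℂ (Matrix (Fin d) (Fin d) ℂ))
    (hT : ∀ X, T X = ∑ i, (V i)ᴴ * X * V i)
    (hsub : ((1 : Matrix (Fin d) (Fin d) ℂ) - T 1).PosSemidef)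
    (hstab : ∃ n : ℕ, 1 ≤ n ∧ (T ^ n) (1 - T 1) = 0) :
    (T ^ d) (1 - T 1) = 0 := by
  obtain ⟨n, -, hn⟩ := hstab
  have htop : tailKer T (1 - T 1) (max d n) = ⊤ := by
    refine eq_top_iff.2 (le_trans (fun v _ => mem_tailKer.2 fun j => ?_)
      (monotone_tailKer (1 - T 1) (le_max_right d n)))
    rw [pow_add, Module.End.mul_apply, hn, map_zero, zero_mulVec]
  have hd_top : tailKer T (1 - T 1) d = ⊤ := by
    refine Submodule.eq_top_of_finrank_eq ?_
    rw [← finrank_tailKer_eq hT hsub (le_max_left d n), htop, finrank_top]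
  refine ext_of_mulVec_single fun i => ?_
  have hi : Pi.single i (1 : ℂ) ∈ tailKer T (1 - T 1) d := hd_top ▸ Submodule.mem_top
  simpa only [zero_mulVec, zero_add] using mem_tailKer.1 hi 0
end

section
/- Let A be a positive semidefinite d × d complex matrix and let V_i (i in a finite index type ι) be d × d complex matrices. Then the range of the matrix ∑_i V_iᴴ · A · V_i (as a linear map on ℂ^d via matrix-vector multiplication) equals the span of the union over i of the images under V_iᴴ of the range of A; that is, Range(∑_i V_iᴴ A V_i) = ⨆_i (V_iᴴ applied to Range(A)) as submodules of ℂ^d. -/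
open Matrix ComplexOrder

/-- The range of `M * Mᴴ` is the range of `M`. -/
theorem range_mulVecLin_self_mul_conjTranspose {m n : Type*} [Fintype m] [Fintype n]
    (M : Matrix m n ℂ) :
    LinearMap.range (M * Mᴴ).mulVecLin = LinearMap.range M.mulVecLin := by
  apply Submodule.eq_of_le_of_finrank_eq
  · rw [Matrix.mulVecLin_mul]
    exact LinearMap.range_comp_le_range _ _
  · exact Matrix.rank_self_mul_conjTranspose M

/-- The range of a matrix made of blocks of columns is the supremum of the ranges of the blocks. -/
theorem range_mulVecLin_blocks {m n ι : Type*} [Fintype n] [Fintype ι]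
    (M : ι → Matrix m n ℂ) :
    LinearMap.range (Matrix.of fun a (p : ι × n) => M p.1 a p.2).mulVecLin =
      ⨆ i, LinearMap.range (M i).mulVecLin := by
  simp only [Matrix.range_mulVecLin]
  rw [← Submodule.span_iUnion]
  congr 1
  ext x
  simp only [Set.mem_range, Set.mem_iUnion, Prod.exists]
  rfl

/-- Range of a CP image of a PSD matrix: for PSD `A` and matrices `V_i`,
the range of `∑ i, V_iᴴ A V_i` (as a linear map on `ℂ^d`) equals the
supremum over `i` of the images under `V_iᴴ` of the range of `A`. -/
theorem stmt_15 {d : ℕ} {ι : Type*} [Fintype ι]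
    (A : Matrix (Fin d) (Fin d) ℂ) (hA : A.PosSemidef)
    (V : ι → Matrix (Fin d) (Fin d) ℂ) :
    LinearMap.range (Matrix.mulVecLin (∑ i, (V i)ᴴ * A * V i)) =
      ⨆ i, Submodule.map (Matrix.mulVecLin (V i)ᴴ)
        (LinearMap.range A.mulVecLin) := by
  obtain ⟨B, rfl⟩ : ∃ B : Matrix (Fin d) (Fin d) ℂ, A = B * Bᴴ := by
    open scoped MatrixOrder in
    obtain ⟨B, hB⟩ := CStarAlgebra.nonneg_iff_eq_mul_star_self.mp hA.nonneg
    exact ⟨B, hB⟩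
  have hsum : ∑ i, (V i)ᴴ * (B * Bᴴ) * V i =
      (Matrix.of fun a (p : ι × Fin d) => ((V p.1)ᴴ * B) a p.2) *
        (Matrix.of fun a (p : ι × Fin d) => ((V p.1)ᴴ * B) a p.2)ᴴ := by
    have hterm (i : ι) : (V i)ᴴ * (B * Bᴴ) * V i = ((V i)ᴴ * B) * ((V i)ᴴ * B)ᴴ := by
      simp [Matrix.conjTranspose_mul, Matrix.mul_assoc]
    ext a b
    simp only [hterm, Matrix.sum_apply]
    rw [Matrix.mul_apply, Fintype.sum_prod_type]
    rfl
  rw [hsum, range_mulVecLin_self_mul_conjTranspose, range_mulVecLin_self_mul_conjTranspose,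
    range_mulVecLin_blocks fun i => (V i)ᴴ * B]
  simp only [Matrix.mulVecLin_mul, LinearMap.range_comp]
end

section
/- Let T : M_d → M_d be the completely positive subunital map T(X) = ∑_{r ∈ ι} V_rᴴ · X · V_r (finite Kraus family, T(1) ≤ 1 in the Loewner order), and let 0 = p₀ ≤ p₁ ≤ ... ≤ p_N be projections in M_d. Then T(p_k) ≤ p_{k-1} holds for all k = 1, ..., N if and only if p_k · V_r · (1 - p_{k-1}) = 0 for all k = 1, ..., N and all r ∈ ι. -/
open Matrix ComplexOrder

/-- If minus a sum of Gram matrices is positive semidefinite, every summand vanishes. -/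
theorem eq_zero_of_posSemidef_neg_sum_conjTranspose_mul_self {n ι : Type*} [Fintype n]
    [Fintype ι] (B : ι → Matrix n n ℂ)
    (h : (-∑ r, (B r)ᴴ * B r).PosSemidef) (r : ι) : B r = 0 := by
  have hnonneg : ∀ r ∈ Finset.univ, 0 ≤ ((B r)ᴴ * B r).trace := fun r _ =>
    (posSemidef_conjTranspose_mul_self (B r)).trace_nonneg
  have hle := h.trace_nonneg
  rw [trace_neg, trace_sum, neg_nonneg] at hle
  have hsum := le_antisymm hle (Finset.sum_nonneg hnonneg)
  exact trace_conjTranspose_mul_self_eq_zero_iff.mp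
    ((Finset.sum_eq_zero_iff_of_nonneg hnonneg).mp hsum r (Finset.mem_univ r))

/-- For projections `e`, `q` and a subunital Kraus map, `∑ r, V_rᴴ e V_r ≤ q` iff every
`V_r` satisfies `e V_r (1 - q) = 0`. -/
theorem posSemidef_sub_kraus_iff {n ι : Type*} [Fintype n] [DecidableEq n] [Fintype ι]
    (V : ι → Matrix n n ℂ) (hsub : (1 - ∑ r, (V r)ᴴ * V r).PosSemidef)
    {e q : Matrix n n ℂ} (he : eᴴ = e) (hee : e * e = e) (hq : qᴴ = q) (hqq : q * q = q) :
    (q - ∑ r, (V r)ᴴ * e * V r).PosSemidef ↔ ∀ r, e * V r * (1 - q) = 0 := by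
  constructor
  · intro h
    apply eq_zero_of_posSemidef_neg_sum_conjTranspose_mul_self
    have hc := h.conjTranspose_mul_mul_same (1 - q)
    convert hc using 1
    have hzero : (1 - q) * q = 0 := by rw [sub_mul, one_mul, hqq, sub_self]
    rw [conjTranspose_sub, conjTranspose_one, hq, mul_sub (1 - q) q, hzero, zero_sub, neg_mul,
      Finset.mul_sum, Finset.sum_mul]
    congr 1
    refine Finset.sum_congr rfl fun r _ => ?_
    rw [conjTranspose_mul, conjTranspose_mul, conjTranspose_sub, conjTranspose_one, hq, he]
    calc (1 - q) * ((V r)ᴴ * e) * (e * V r * (1 - q))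
        = (1 - q) * (V r)ᴴ * (e * e) * V r * (1 - q) := by simp only [mul_assoc]
      _ = (1 - q) * ((V r)ᴴ * e * V r) * (1 - q) := by rw [hee]; simp only [mul_assoc]
  · intro h
    have hright : ∀ r, e * V r * q = e * V r := fun r => by
      have hr := h r
      rw [mul_sub, mul_one, sub_eq_zero] at hr
      exact hr.symm
    have hleft : ∀ r, q * ((V r)ᴴ * e) = (V r)ᴴ * e := fun r => by
      have hr := congrArg conjTranspose (hright r)
      simpa only [conjTranspose_mul, hq, he] using hr
    have hcompl : (1 - e)ᴴ * (1 - e) = 1 - e := by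
      rw [conjTranspose_sub, conjTranspose_one, he, mul_sub, mul_one, sub_mul, one_mul, hee,
        sub_self, sub_zero]
    have hpos : (∑ r, (V r)ᴴ * (1 - e) * V r).PosSemidef :=
      posSemidef_sum _ fun r _ =>
        (hcompl ▸ posSemidef_conjTranspose_mul_self (1 - e)).conjTranspose_mul_mul_same (V r)
    have hc := (hsub.add hpos).conjTranspose_mul_mul_same q
    convert hc using 1
    have hsplit : 1 - ∑ r, (V r)ᴴ * V r + ∑ r, (V r)ᴴ * (1 - e) * V r
        = 1 - ∑ r, (V r)ᴴ * e * V r := by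
      simp only [mul_sub, sub_mul, mul_one, Finset.sum_sub_distrib]
      abel
    rw [hsplit, hq, mul_sub, sub_mul, mul_one, hqq, Finset.mul_sum, Finset.sum_mul]
    congr 1
    refine Finset.sum_congr rfl fun r _ => ?_
    rw [← mul_assoc, hleft, mul_assoc (V r)ᴴ e, mul_assoc (V r)ᴴ, hright]

/-- Filtration ⇔ Kraus level lowering: for a CP subunital map
`T(X) = ∑ r, V_rᴴ X V_r` and a chain of projections `0 = p₀ ≤ p₁ ≤ ⋯ ≤ p_N`,
one has `T(p_k) ≤ p_{k-1}` for all `k = 1, …, N` iff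
`p_k · V_r · (1 - p_{k-1}) = 0` for all such `k` and all `r`. -/
theorem stmt_17 {d : ℕ} {ι : Type*} [Fintype ι]
    (V : ι → Matrix (Fin d) (Fin d) ℂ)
    (T : Module.End ℂ (Matrix (Fin d) (Fin d) ℂ))
    (hT : ∀ X, T X = ∑ r, (V r)ᴴ * X * V r)
    (hsub : ((1 : Matrix (Fin d) (Fin d) ℂ) - T 1).PosSemidef)
    (N : ℕ) (p : ℕ → Matrix (Fin d) (Fin d) ℂ)
    (hproj : ∀ k ≤ N, (p k)ᴴ = p k ∧ p k * p k = p k)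
    (hp0 : p 0 = 0)
    (hchain : ∀ k < N, (p (k + 1) - p k).PosSemidef) :
    (∀ k, 1 ≤ k → k ≤ N → (p (k - 1) - T (p k)).PosSemidef) ↔
    (∀ k, 1 ≤ k → k ≤ N → ∀ r, p k * V r * (1 - p (k - 1)) = 0) := by
  have hsub' : (1 - ∑ r, (V r)ᴴ * V r).PosSemidef := by
    simpa only [hT, mul_one] using hsub
  refine forall_congr' fun k => forall_congr' fun _ => forall_congr' fun hkN => ?_
  obtain ⟨he, hee⟩ := hproj k hkN
  obtain ⟨hq, hqq⟩ := hproj (k - 1) (by omega)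
  rw [hT]
  exact posSemidef_sub_kraus_iff V hsub' he hee hq hqq
end
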